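/- arXiv:2303.02780 — 2 statements merged into one kernel-verified Lean document; each statement's English description precedes it below -/
import Mathlib

section
/- Let P be a nonconstant polynomial over ℂ with factorization P = C·∏ᵢ₌₁ʳ (X − rᵢ)^{mᵢ}, where C ≠ 0, the rᵢ are pairwise distinct and mᵢ ≥ 1, and suppose there is an index j such that m_j > mᵢ for all i ≠ j (the multiplicity m_j is strictly maximal) and m_j ≥ 2. Define τ₀ = P and τ_k = gcd(τ_{k−1}, τ_{k−1}′) for k ≥ 1. Then τ_{m_j − 1} has degree 1 and its unique root is r_j; in particular r_j = −(constant coefficient of τ_{m_j − 1})/(leading coefficient of τ_{m_j − 1}). -/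
open Polynomial

theorem rootMultiplicity_gcd_derivative {K : Type*} [Field K] [CharZero K] [DecidableEq K]
    {p : K[X]} (hp : p ≠ 0) (t : K) :
    (EuclideanDomain.gcd p (derivative p)).rootMultiplicity t = p.rootMultiplicity t - 1 := by
  have hg : EuclideanDomain.gcd p (derivative p) ≠ 0 := fun h =>
    hp (EuclideanDomain.gcd_eq_zero_iff.mp h).1
  refine eq_of_forall_le_iff fun n => ?_
  have hdvd : (X - C t) ^ n ∣ EuclideanDomain.gcd p (derivative p) ↔
      (X - C t) ^ n ∣ p ∧ (X - C t) ^ n ∣ derivative p :=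
    ⟨fun h => ⟨h.trans (EuclideanDomain.gcd_dvd_left _ _),
      h.trans (EuclideanDomain.gcd_dvd_right _ _)⟩, fun h => EuclideanDomain.dvd_gcd h.1 h.2⟩
  rw [le_rootMultiplicity_iff hg, hdvd, ← le_rootMultiplicity_iff hp]
  by_cases h0 : derivative p = 0
  · obtain ⟨a, rfl⟩ := natDegree_eq_zero.mp (derivative_eq_zero.mp h0)
    simp
  rw [← le_rootMultiplicity_iff h0]
  by_cases hr : p.IsRoot t
  · rw [derivative_rootMultiplicity_of_root hr]
    omega
  · rw [rootMultiplicity_eq_zero hr]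
    omega

theorem rootMultiplicity_iterated_gcd_derivative {K : Type*} [Field K] [CharZero K]
    [DecidableEq K] {τ : ℕ → K[X]} (h0 : τ 0 ≠ 0)
    (hτ : ∀ k, τ (k + 1) = EuclideanDomain.gcd (τ k) (derivative (τ k))) (k : ℕ) :
    τ k ≠ 0 ∧ ∀ t, (τ k).rootMultiplicity t = (τ 0).rootMultiplicity t - k := by
  induction k with
  | zero => exact ⟨h0, fun t => rfl⟩
  | succ k ih =>
    rw [hτ]
    refine ⟨fun h => ih.1 (EuclideanDomain.gcd_eq_zero_iff.mp h).1, fun t => ?_⟩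
    rw [rootMultiplicity_gcd_derivative ih.1, ih.2, Nat.sub_sub]

theorem rootMultiplicity_C_mul_prod_X_sub_C_pow {K ι : Type*} [Field K] [DecidableEq K]
    [Fintype ι] {c : K} (hc : c ≠ 0) (r : ι → K) (m : ι → ℕ) (t : K) :
    (C c * ∏ i, (X - C (r i)) ^ m i).rootMultiplicity t = ∑ i, if t = r i then m i else 0 := by
  have h : ∏ i, (X - C (r i)) ^ m i ≠ 0 :=
    Finset.prod_ne_zero_iff.mpr fun i _ => pow_ne_zero _ (X_sub_C_ne_zero _)
  rw [← count_roots, roots_C_mul _ hc, roots_prod _ _ h, Multiset.count_bind]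
  simp [Multiset.count_nsmul, Multiset.count_singleton]

theorem iterated_gcd_isolates_strictly_maximal_multiplicity (P : Polynomial ℂ) (c : ℂ)
    (n : ℕ) (r : Fin n → ℂ) (m : Fin n → ℕ) (hc : c ≠ 0) (hr : Function.Injective r)
    (hm : ∀ i, 1 ≤ m i)
    (hP : P = Polynomial.C c * ∏ i, (X - Polynomial.C (r i)) ^ m i)
    (hdeg : 0 < P.degree)
    (j : Fin n) (hmax : ∀ i, i ≠ j → m i < m j) (hj2 : 2 ≤ m j)
    (τ : ℕ → Polynomial ℂ) (hτ0 : τ 0 = P)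
    (hτ : ∀ k, τ (k + 1) = EuclideanDomain.gcd (τ k) (Polynomial.derivative (τ k))) :
    (τ (m j - 1)).degree = 1 ∧
      (∀ z : ℂ, (τ (m j - 1)).eval z = 0 ↔ z = r j) ∧
      r j = -((τ (m j - 1)).coeff 0) / (τ (m j - 1)).leadingCoeff := by
  classical
  have hP0 : τ 0 ≠ 0 := by
    rw [hτ0]
    exact ne_zero_of_degree_gt hdeg
  obtain ⟨hne, hmult⟩ := rootMultiplicity_iterated_gcd_derivative hP0
    (fun k => by convert hτ k) (m j - 1)
  rw [hτ0, hP] at hmult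
  simp only [rootMultiplicity_C_mul_prod_X_sub_C_pow hc] at hmult
  generalize τ (m j - 1) = q at hne hmult ⊢
  have hroots : q.roots = {r j} := by
    ext z
    rw [count_roots, hmult, Multiset.count_singleton]
    by_cases hz : ∃ i, z = r i
    · obtain ⟨i, rfl⟩ := hz
      simp only [hr.eq_iff, Finset.sum_ite_eq, Finset.mem_univ, if_true]
      split_ifs with h
      · subst h
        omega
      · have := hmax i h
        omega
    · push Not at hz
      simp [hz]
  have hlc : q.leadingCoeff ≠ 0 := leadingCoeff_ne_zero.mpr hne
  have hq : q = C q.leadingCoeff * (X - C (r j)) := by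
    simpa [hroots] using (IsAlgClosed.splits q).eq_prod_roots
  refine ⟨?_, fun z => ?_, ?_⟩
  · rw [hq, degree_C_mul hlc, degree_X_sub_C]
  · rw [← IsRoot.def, ← mem_roots hne, hroots, Multiset.mem_singleton]
  · have h0 : q.coeff 0 = q.leadingCoeff * -r j := by
      conv_lhs => rw [hq]
      simp
    rw [h0]
    field_simp
end

section
/- Let A and B be 4×4 real symmetric matrices defining ellipsoids, i.e., for M ∈ {A, B} the upper-left 3×3 block of M is positive definite and det M < 0. Let f(λ) = det(λ·A + B), a quartic polynomial in λ with leading coefficient det A ≠ 0. Then f has at least two negative real roots counted with multiplicity (i.e., the total multiplicity of the roots of f lying in (−∞, 0) is at least 2). -/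
/-- A 4×4 real symmetric matrix defines an ellipsoid when its upper-left 3×3 block is
positive definite and its determinant is negative. -/
def IsEllipsoidMatrix (M : Matrix (Fin 4) (Fin 4) ℝ) : Prop :=
  M.IsSymm ∧ (Matrix.of fun i j : Fin 3 => M i.castSucc j.castSucc).PosDef ∧ M.det < 0

/-- The characteristic polynomial `f(λ) = det (λ A + B)` of the pencil of `A` and `B`. -/
noncomputable def pencilPoly (A B : Matrix (Fin 4) (Fin 4) ℝ) : Polynomial ℝ :=
  (Matrix.of fun i j =>
    Polynomial.C (A i j) * Polynomial.X + Polynomial.C (B i j)).det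

open Matrix Polynomial in
lemma eval_pencilPoly (A B : Matrix (Fin 4) (Fin 4) ℝ) (t : ℝ) :
    (pencilPoly A B).eval t = (t • A + B).det := by
  rw [pencilPoly, ← coe_evalRingHom, RingHom.map_det]
  congr 1
  ext i j
  simp only [RingHom.mapMatrix_apply, map_apply, of_apply, coe_evalRingHom, eval_add, eval_mul,
    eval_C, eval_X, Matrix.add_apply, Matrix.smul_apply, smul_eq_mul, mul_comm t]

open Polynomial in
/-- A real polynomial that is negative at `0` and at `l`, and nonnegative at some point strictly
between them, has two negative roots counted with multiplicity. -/
lemma Polynomial.two_le_card_neg_roots {p : ℝ[X]} {l x : ℝ} (h0 : p.eval 0 < 0)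
    (hl : p.eval l < 0) (hlx : l < x) (hx0 : x < 0) (hx : 0 ≤ p.eval x) :
    2 ≤ Multiset.card (p.roots.filter (fun y => y < 0)) := by
  have hp : p ≠ 0 := by rintro rfl; simp at h0
  by_cases h : ∃ y ∈ Set.Ioo l 0, 0 < p.eval y
  · obtain ⟨y, ⟨hly, hy0⟩, hy⟩ := h
    obtain ⟨a, ⟨-, hay⟩, ha⟩ :=
      intermediate_value_Ioo hly.le p.continuous.continuousOn ⟨hl, hy⟩
    obtain ⟨b, ⟨hyb, hb0⟩, hb⟩ :=
      intermediate_value_Ioo' hy0.le p.continuous.continuousOn ⟨h0, hy⟩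
    have hab : a ≠ b := (hay.trans hyb).ne
    have hle : ({a, b} : Multiset ℝ) ≤ p.roots.filter (fun y => y < 0) := by
      rw [Multiset.le_iff_subset (by simp [hab])]
      intro z hz
      simp only [Multiset.insert_eq_cons, Multiset.mem_cons, Multiset.mem_singleton] at hz
      rw [Multiset.mem_filter, mem_roots hp]
      rcases hz with rfl | rfl
      · exact ⟨ha, hay.trans hy0⟩
      · exact ⟨hb, hb0⟩
    simpa using Multiset.card_le_card hle
  · push Not at h
    have hroot : p.eval x = 0 := le_antisymm (h x ⟨hlx, hx0⟩) hx
    have hmax : IsLocalMax (fun y => p.eval y) x := by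
      filter_upwards [Ioo_mem_nhds hlx hx0] with y hy
      exact hroot ▸ h y hy
    have hder : p.derivative.eval x = 0 := by
      rw [← p.deriv]
      exact hmax.deriv_eq_zero
    have hmult : 1 < p.rootMultiplicity x :=
      (one_lt_rootMultiplicity_iff_isRoot hp).2 ⟨hroot, hder⟩
    calc 2 ≤ p.rootMultiplicity x := hmult
      _ = (p.roots.filter (fun y => y < 0)).count x := by
        rw [Multiset.count_filter_of_pos (p := fun y => y < 0) hx0, count_roots]
      _ ≤ _ := Multiset.count_le_card _ _

open Filter Topology in
/-- If `det A < 0`, then `det (t A + B)` is negative for some arbitrarily negative `t`, when the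
size of the matrices is even. -/
lemma Matrix.exists_lt_det_smul_add_neg {n : Type*} [Fintype n] [DecidableEq n]
    (hn : Even (Fintype.card n)) {A : Matrix n n ℝ} (B : Matrix n n ℝ) (hA : A.det < 0) (x : ℝ) :
    ∃ l < x, (l • A + B).det < 0 := by
  have hc : Continuous fun s : ℝ => (A + s • B).det := by fun_prop
  have hlim : Tendsto (fun t : ℝ => (A + t⁻¹ • B).det) atBot (𝓝 A.det) := by
    have := (hc.tendsto 0).comp tendsto_inv_atBot_zero
    simpa [Function.comp_def] using this
  obtain ⟨l, hl, hlx, hl0⟩ := ((hlim.eventually (gt_mem_nhds hA)).and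
    ((eventually_lt_atBot x).and (eventually_lt_atBot 0))).exists
  refine ⟨l, hlx, ?_⟩
  have hfac : l • A + B = l • (A + l⁻¹ • B) := by
    rw [smul_add, smul_smul, mul_inv_cancel₀ hl0.ne, one_smul]
  rw [hfac, Matrix.det_smul]
  exact mul_neg_of_pos_of_neg (hn.pow_pos hl0.ne) hl

open Matrix Unitary in
lemma Matrix.IsHermitian.exists_transpose_mul_mul_eq_diagonal {n : Type*} [Fintype n]
    [DecidableEq n] {A : Matrix n n ℝ} (hA : A.IsHermitian) :
    ∃ (U : Matrix n n ℝ) (d : n → ℝ), Uᵀ * U = 1 ∧ Uᵀ * A * U = diagonal d := by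
  refine ⟨hA.eigenvectorUnitary, hA.eigenvalues, ?_, ?_⟩
  · have h := coe_star_mul_self hA.eigenvectorUnitary
    rwa [star_eq_conjTranspose, conjTranspose_eq_transpose_of_trivial] at h
  · have h := hA.conjStarAlgAut_star_eigenvectorUnitary
    rw [conjStarAlgAut_star_apply, star_eq_conjTranspose,
      conjTranspose_eq_transpose_of_trivial] at h
    exact h

open Matrix in
/-- Simultaneous diagonalization by congruence of two positive definite matrices. -/
lemma Matrix.PosDef.exists_transpose_mul_mul_eq_one_and_diagonal {n : Type*} [Fintype n]
    [DecidableEq n] {A B : Matrix n n ℝ} (hA : A.PosDef) (hB : B.PosDef) :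
    ∃ (R : Matrix n n ℝ) (d : n → ℝ), R.det ≠ 0 ∧ (∀ i, 0 < d i) ∧
      Rᵀ * A * R = 1 ∧ Rᵀ * B * R = diagonal d := by
  have pos {C S : Matrix n n ℝ} (hC : C.PosDef) (hS : S.det ≠ 0) : (Sᵀ * C * S).PosDef := by
    have hU : IsUnit S := (isUnit_iff_isUnit_det S).2 hS.isUnit
    have := (IsUnit.posDef_star_left_conjugate_iff hU).2 hC
    rwa [star_eq_conjTranspose, conjTranspose_eq_transpose_of_trivial] at this
  have det_ne {S : Matrix n n ℝ} (hS : Sᵀ * S = 1) : S.det ≠ 0 := det_ne_zero_of_left_inverse hS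
  obtain ⟨U, a, hU, hUa⟩ := hA.isHermitian.exists_transpose_mul_mul_eq_diagonal
  have ha : ∀ i, 0 < a i := posDef_diagonal_iff.1 (hUa ▸ pos hA (det_ne hU))
  set D : Matrix n n ℝ := diagonal fun i => (√(a i))⁻¹ with hD
  have hDdet : D.det ≠ 0 := by
    rw [hD, det_diagonal]
    exact Finset.prod_ne_zero_iff.2 fun i _ => inv_ne_zero (Real.sqrt_pos.2 (ha i)).ne'
  have hT : (U * D)ᵀ * A * (U * D) = 1 := by
    calc (U * D)ᵀ * A * (U * D) = Dᵀ * (Uᵀ * A * U) * D := by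
          simp only [transpose_mul, Matrix.mul_assoc]
      _ = 1 := by
          rw [hUa, hD, diagonal_transpose, diagonal_mul_diagonal, diagonal_mul_diagonal,
            ← diagonal_one]
          congr 1
          ext i
          have := (Real.sqrt_pos.2 (ha i)).ne'
          field_simp
          rw [Real.sq_sqrt (ha i).le]
  have hTdet : (U * D).det ≠ 0 := by
    rw [det_mul]
    exact mul_ne_zero (det_ne hU) hDdet
  obtain ⟨V, d, hV, hVd⟩ := (pos hB hTdet).isHermitian.exists_transpose_mul_mul_eq_diagonal
  refine ⟨U * D * V, d, ?_, posDef_diagonal_iff.1 (hVd ▸ pos (pos hB hTdet) (det_ne hV)), ?_, ?_⟩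
  · rw [det_mul]
    exact mul_ne_zero hTdet (det_ne hV)
  · calc (U * D * V)ᵀ * A * (U * D * V) = Vᵀ * ((U * D)ᵀ * A * (U * D)) * V := by
          simp only [transpose_mul, Matrix.mul_assoc]
      _ = 1 := by rw [hT, Matrix.mul_one, hV]
  · rw [← hVd]
    simp only [transpose_mul, Matrix.mul_assoc]

/-- Among three reals there is one in the middle position. -/
lemma exists_middle (d : Fin 3 → ℝ) :
    ∃ i, ∀ j k, j ≠ i → k ≠ i → j ≠ k → (d j - d i) * (d k - d i) ≤ 0 := by
  have key (i j k : Fin 3) (hjk : ∀ l, l ≠ i → l = j ∨ l = k) (h1 : d j ≤ d i) (h2 : d i ≤ d k) :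
      ∃ i, ∀ j k, j ≠ i → k ≠ i → j ≠ k → (d j - d i) * (d k - d i) ≤ 0 := by
    refine ⟨i, fun j' k' hj hk hne => ?_⟩
    rcases hjk j' hj with rfl | rfl <;> rcases hjk k' hk with rfl | rfl
    · exact absurd rfl hne
    · nlinarith
    · nlinarith
    · exact absurd rfl hne
  rcases le_total (d 0) (d 1) with h01 | h01 <;> rcases le_total (d 1) (d 2) with h12 | h12 <;>
    rcases le_total (d 0) (d 2) with h02 | h02
  · exact key 1 0 2 (by decide) h01 h12
  · exact key 1 0 2 (by decide) h01 h12
  · exact key 2 0 1 (by decide) h02 h12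
  · exact key 0 2 1 (by decide) h02 h01
  · exact key 0 1 2 (by decide) h01 h02
  · exact key 2 1 0 (by decide) h12 h02
  · exact key 1 2 0 (by decide) h12 h01
  · exact key 1 2 0 (by decide) h12 h01

open Matrix in
/-- A bordered diagonal matrix has nonnegative determinant if one diagonal entry vanishes and the
other two have opposite signs. -/
lemma Matrix.det_fromBlocks_diagonal_nonneg (e : Fin 3 → ℝ) (b : Matrix (Fin 3) (Fin 1) ℝ)
    (c : Matrix (Fin 1) (Fin 1) ℝ) {i : Fin 3} (hi : e i = 0)
    (he : ∀ j k, j ≠ i → k ≠ i → j ≠ k → e j * e k ≤ 0) :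
    0 ≤ (fromBlocks (diagonal e) b bᵀ c).det := by
  have hdet : (fromBlocks (diagonal e) b bᵀ c).det = e 0 * e 1 * e 2 * c 0 0
      - b 0 0 ^ 2 * (e 1 * e 2) - b 1 0 ^ 2 * (e 0 * e 2) - b 2 0 ^ 2 * (e 0 * e 1) := by
    have h (k : Fin 3) : (finSumFinEquiv (m := 3) (n := 1)).symm k.castSucc = Sum.inl k :=
      finSumFinEquiv_symm_apply_castAdd k
    have h3 : (finSumFinEquiv (m := 3) (n := 1)).symm 3 = Sum.inr 0 := rfl
    have h0 := h 0
    have h1 := h 1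
    have h2 := h 2
    simp only [Fin.castSucc_zero, Fin.castSucc_one, Fin.reduceCastSucc, Nat.reduceAdd] at h0 h1 h2 h3
    rw [← det_submatrix_equiv_self (finSumFinEquiv (m := 3) (n := 1)).symm, det_succ_row_zero]
    simp [Fin.sum_univ_succ, det_fin_three, Fin.succAbove, h0, h1, h2, h3]
    ring
  rw [hdet]
  fin_cases i <;> simp at hi <;> rw [hi]
  · nlinarith [he 1 2 (by decide) (by decide) (by decide), sq_nonneg (b 0 0)]
  · nlinarith [he 0 2 (by decide) (by decide) (by decide), sq_nonneg (b 1 0)]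
  · nlinarith [he 0 1 (by decide) (by decide) (by decide), sq_nonneg (b 2 0)]

open Matrix in
lemma Matrix.exists_neg_det_smul_add_nonneg {A B : Matrix (Fin 3 ⊕ Fin 1) (Fin 3 ⊕ Fin 1) ℝ}
    (hA : A.IsSymm) (hB : B.IsSymm) (hA₁ : A.toBlocks₁₁.PosDef) (hB₁ : B.toBlocks₁₁.PosDef) :
    ∃ x < (0 : ℝ), 0 ≤ (x • A + B).det := by
  obtain ⟨R, d, hR, hd, hRA, hRB⟩ := hA₁.exists_transpose_mul_mul_eq_one_and_diagonal hB₁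
  obtain ⟨i, hi⟩ := exists_middle d
  refine ⟨-d i, neg_lt_zero.2 (hd i), ?_⟩
  set M := (-d i) • A + B with hM
  have hMsymm : M.IsSymm := (hA.smul _).add hB
  have h21 : M.toBlocks₂₁ = M.toBlocks₁₂ᵀ := by
    ext j k
    exact hMsymm.apply _ _
  have h11 : Rᵀ * M.toBlocks₁₁ * R = diagonal fun j => d j - d i := by
    have : M.toBlocks₁₁ = -d i • A.toBlocks₁₁ + B.toBlocks₁₁ := rfl
    rw [this, Matrix.mul_add, Matrix.add_mul, Matrix.mul_smul, Matrix.smul_mul, hRA, hRB,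
      smul_one_eq_diagonal, diagonal_add]
    congr 1
    ext j
    ring
  set P : Matrix (Fin 3 ⊕ Fin 1) (Fin 3 ⊕ Fin 1) ℝ := fromBlocks R 0 0 1 with hP
  have hPM : Pᵀ * M * P = fromBlocks (diagonal fun j => d j - d i) (Rᵀ * M.toBlocks₁₂)
      (Rᵀ * M.toBlocks₁₂)ᵀ M.toBlocks₂₂ := by
    rw [← M.fromBlocks_toBlocks, hP, fromBlocks_transpose, fromBlocks_multiply,
      fromBlocks_multiply]
    simp [h11, h21]
  have hdet : 0 ≤ (Pᵀ * M * P).det := by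
    rw [hPM]
    exact det_fromBlocks_diagonal_nonneg _ _ _ (i := i) (sub_self _) hi
  have hPdet : P.det = R.det := by simp [hP]
  rw [det_mul, det_mul, det_transpose, hPdet, mul_right_comm] at hdet
  exact nonneg_of_mul_nonneg_right hdet (mul_self_pos.2 hR)

theorem pencil_of_ellipsoids_two_negative_roots (A B : Matrix (Fin 4) (Fin 4) ℝ)
    (hA : IsEllipsoidMatrix A) (hB : IsEllipsoidMatrix B) :
    2 ≤ Multiset.card ((pencilPoly A B).roots.filter (fun x => x < 0)) := by
  obtain ⟨hAs, hA₁, hAd⟩ := hA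
  obtain ⟨hBs, hB₁, hBd⟩ := hB
  let e : Fin 3 ⊕ Fin 1 ≃ Fin 4 := finSumFinEquiv
  obtain ⟨x, hx0, hx⟩ := Matrix.exists_neg_det_smul_add_nonneg (hAs.submatrix e)
    (hBs.submatrix e) hA₁ hB₁
  have hx' : 0 ≤ (x • A + B).det := by
    rw [← Matrix.det_submatrix_equiv_self e]
    exact hx
  obtain ⟨l, hlx, hl⟩ := Matrix.exists_lt_det_smul_add_neg (by decide) B hAd x
  exact Polynomial.two_le_card_neg_roots (l := l) (x := x) (by simpa [eval_pencilPoly] using hBd)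
    (by rwa [eval_pencilPoly]) hlx hx0 (by rwa [eval_pencilPoly])
end
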